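/- Let p ≥ 1 be an integer, let μ > 0 and D ≥ 0, and let f : ℝ^p → ℝ be convex and D-Lipschitz. Then the gradient of the Gaussian smoothing f_μ is Lipschitz continuous with constant √p · D / μ; that is, for all x, y ∈ ℝ^p, ‖∇f_μ(x) − ∇f_μ(y)‖ ≤ (√p · D / μ) · ‖x − y‖. -/

import Mathlib

open MeasureTheory Real

/-- The standard Gaussian measure on `ℝ^p`: the measure with density
`(2π)^(-p/2) exp(-‖ξ‖²/2)` with respect to Lebesgue measure. -/
noncomputable def stdGaussian (p : ℕ) : Measure (EuclideanSpace ℝ (Fin p)) :=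
  volume.withDensity fun ξ =>
    ENNReal.ofReal ((2 * π) ^ (-(p : ℝ) / 2) * Real.exp (-‖ξ‖ ^ 2 / 2))

section helpers

variable {p : ℕ}

lemma gs_integrable_exp {b : ℝ} (hb : 0 < b) :
    Integrable (fun v : EuclideanSpace ℝ (Fin p) => Real.exp (-b * ‖v‖ ^ 2)) := by
  by_contra h
  have h1 := GaussianFourier.integral_rexp_neg_mul_sq_norm (V := EuclideanSpace ℝ (Fin p)) hb
  rw [integral_undef h] at h1
  have : 0 < (π / b) ^ ((Module.finrank ℝ (EuclideanSpace ℝ (Fin p)) : ℝ) / 2) := by positivity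
  linarith

/-- the Gaussian density -/
noncomputable def gsDens (p : ℕ) (ξ : EuclideanSpace ℝ (Fin p)) : ℝ :=
  (2 * π) ^ (-(p : ℝ) / 2) * Real.exp (-‖ξ‖ ^ 2 / 2)

lemma gsDens_nonneg (ξ : EuclideanSpace ℝ (Fin p)) : 0 ≤ gsDens p ξ := by
  unfold gsDens; positivity

lemma gsDens_continuous : Continuous (gsDens p) := by
  unfold gsDens; fun_prop

lemma gs_integral (g : EuclideanSpace ℝ (Fin p) → ℝ) :
    ∫ ξ, g ξ ∂(stdGaussian p) = ∫ ξ, gsDens p ξ * g ξ := by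
  unfold stdGaussian
  rw [integral_withDensity_eq_integral_toReal_smul]
  · congr 1
    ext ξ
    change (ENNReal.ofReal (gsDens p ξ)).toReal • g ξ = _
    rw [ENNReal.toReal_ofReal (gsDens_nonneg ξ), smul_eq_mul]
  · exact (gsDens_continuous (p := p)).measurable.ennreal_ofReal
  · simp

lemma gs_integral_exp {s : ℝ} (hs : s < 1 / 2) :
    ∫ ξ, (2 * π) ^ (-(p : ℝ) / 2) * Real.exp (-(1 / 2 - s) * ‖(ξ : EuclideanSpace ℝ (Fin p))‖ ^ 2)
      = (1 - 2 * s) ^ (-(p : ℝ) / 2) := by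
  have h0 : 0 < 1 - 2 * s := by linarith
  rw [integral_const_mul, GaussianFourier.integral_rexp_neg_mul_sq_norm (by linarith)]
  have : π / (1 / 2 - s) = (2 * π) * (1 - 2 * s)⁻¹ := by
    have : 1 / 2 - s ≠ 0 := by linarith
    field_simp
  rw [this, Real.mul_rpow (x := 2 * π) (y := (1 - 2 * s)⁻¹) (by positivity) (by positivity),
    ← mul_assoc, ← Real.rpow_add (by positivity), Real.inv_rpow h0.le, ← Real.rpow_neg h0.le]
  simp only [finrank_euclideanSpace, Fintype.card_fin]
  rw [show -(p : ℝ) / 2 + p / 2 = 0 by ring, Real.rpow_zero, one_mul]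
  congr 1; ring

lemma gs_poly_bound (t b : ℝ) (hb : 0 < b) : 1 + t ^ 2 ≤ (1 + 1 / b) * Real.exp (b * t ^ 2) := by
  have h := Real.add_one_le_exp (b * t ^ 2)
  have h2 : (1 + 1 / b) * (b * t ^ 2 + 1) = b * t ^ 2 + 1 + t ^ 2 + 1 / b := by
    field_simp; ring
  have h3 : (1 + 1 / b) * (b * t ^ 2 + 1) ≤ (1 + 1 / b) * Real.exp (b * t ^ 2) := by gcongr
  have : 0 < 1 / b := by positivity
  nlinarith [sq_nonneg t, mul_nonneg hb.le (sq_nonneg t)]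

lemma gs_integrable_sq :
    Integrable (fun ξ : EuclideanSpace ℝ (Fin p) => gsDens p ξ * (1 + ‖ξ‖ ^ 2)) := by
  have hi := (gs_integrable_exp (p := p) (b := 1 / 4) (by norm_num)).const_mul
    ((2 * π) ^ (-(p : ℝ) / 2) * 5)
  refine hi.mono' ?_ (Filter.Eventually.of_forall fun ξ => ?_)
  · have := gsDens_continuous (p := p)
    exact Continuous.aestronglyMeasurable (by fun_prop)
  · have h := gs_poly_bound ‖ξ‖ (1 / 4) (by norm_num)
    rw [Real.norm_of_nonneg (mul_nonneg (gsDens_nonneg ξ) (by positivity))]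
    unfold gsDens
    calc (2 * π) ^ (-(p : ℝ) / 2) * Real.exp (-‖ξ‖ ^ 2 / 2) * (1 + ‖ξ‖ ^ 2)
        ≤ (2 * π) ^ (-(p : ℝ) / 2) * Real.exp (-‖ξ‖ ^ 2 / 2)
          * ((1 + 1 / (1 / 4)) * Real.exp (1 / 4 * ‖ξ‖ ^ 2)) := by gcongr
      _ = (2 * π) ^ (-(p : ℝ) / 2) * 5 *
          (Real.exp (-‖ξ‖ ^ 2 / 2) * Real.exp (1 / 4 * ‖ξ‖ ^ 2)) := by ring
      _ = _ := by rw [← Real.exp_add]; congr 2; ring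

lemma gs_integrable_dens : Integrable (gsDens p) := by
  refine (gs_integrable_sq (p := p)).mono' gsDens_continuous.aestronglyMeasurable
    (Filter.Eventually.of_forall fun ξ => ?_)
  rw [Real.norm_of_nonneg (gsDens_nonneg ξ)]
  nlinarith [gsDens_nonneg ξ, mul_nonneg (gsDens_nonneg ξ) (sq_nonneg ‖ξ‖)]

lemma gs_integrable_norm_sq :
    Integrable (fun ξ : EuclideanSpace ℝ (Fin p) => gsDens p ξ * ‖ξ‖ ^ 2) := by
  have := (gs_integrable_sq (p := p)).sub gs_integrable_dens
  refine this.congr (Filter.Eventually.of_forall fun ξ => ?_)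
  simp only [Pi.sub_apply]; ring

lemma gs_integrable_norm :
    Integrable (fun ξ : EuclideanSpace ℝ (Fin p) => gsDens p ξ * ‖ξ‖) := by
  have hc := gsDens_continuous (p := p)
  refine (gs_integrable_sq (p := p)).mono' (Continuous.aestronglyMeasurable (by fun_prop))
    (Filter.Eventually.of_forall fun ξ => ?_)
  rw [Real.norm_of_nonneg (mul_nonneg (gsDens_nonneg ξ) (by positivity))]
  refine mul_le_mul_of_nonneg_left ?_ (gsDens_nonneg ξ)
  nlinarith [sq_nonneg (‖ξ‖ - 1)]

lemma gs_integral_dens : ∫ ξ, gsDens p ξ = 1 := by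
  have := gs_integral_exp (p := p) (s := 0) (by norm_num)
  rw [show (1 : ℝ) - 2 * 0 = 1 by norm_num, Real.one_rpow] at this
  rw [← this]
  congr 1; ext ξ; unfold gsDens; congr 2; ring

lemma gs_integral_norm_sq : ∫ ξ, gsDens p ξ * ‖ξ‖ ^ 2 ≤ p := by
  set M := ∫ ξ, gsDens p ξ * ‖ξ‖ ^ 2 with hM
  have key : ∀ s : ℝ, 0 < s → s < 1 / 2 → 1 + s * M ≤ (1 - 2 * s) ^ (-(p : ℝ) / 2) := by
    intro s hs hs2
    rw [← gs_integral_exp hs2, hM, ← integral_const_mul]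
    nth_rewrite 1 [← gs_integral_dens (p := p)]
    rw [← integral_add gs_integrable_dens (gs_integrable_norm_sq.const_mul s)]
    refine integral_mono (gs_integrable_dens.add (gs_integrable_norm_sq.const_mul s))
      ((gs_integrable_exp (by linarith)).const_mul _) fun ξ => ?_
    have h := Real.add_one_le_exp (s * ‖ξ‖ ^ 2)
    have h2 : (2 * π) ^ (-(p : ℝ) / 2) * Real.exp (-(1 / 2 - s) * ‖ξ‖ ^ 2)
        = gsDens p ξ * Real.exp (s * ‖ξ‖ ^ 2) := by
      unfold gsDens
      rw [mul_assoc, ← Real.exp_add]; congr 2; ring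
    simp only [h2]
    nlinarith [gsDens_nonneg ξ, mul_le_mul_of_nonneg_left h (gsDens_nonneg ξ)]
  have hd : HasDerivAt (fun s : ℝ => (1 - 2 * s) ^ (-(p : ℝ) / 2)) (p : ℝ) 0 := by
    have h1 : HasDerivAt (fun s : ℝ => 1 - 2 * s) (-2) 0 := by
      simpa using ((hasDerivAt_id (0 : ℝ)).const_mul 2).const_sub 1
    have := h1.rpow_const (p := -(p : ℝ) / 2) (by norm_num)
    convert this using 1
    norm_num
    ring
  have ht := hd.tendsto_slope_zero_right
  refine ge_of_tendsto ht ?_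
  filter_upwards [Ioo_mem_nhdsGT (show (0 : ℝ) < 1 / 2 by norm_num)] with s hs
  have := key s hs.1 hs.2
  simp only [zero_add, mul_zero, sub_zero, Real.one_rpow, smul_eq_mul]
  rw [inv_mul_eq_div, le_div_iff₀ hs.1]
  linarith

lemma gs_integral_norm (hp : 1 ≤ p) : ∫ ξ, gsDens p ξ * ‖ξ‖ ≤ Real.sqrt p := by
  have hp' : (0 : ℝ) < p := by exact_mod_cast hp
  set q := Real.sqrt p with hq
  have hqp : 0 < q := Real.sqrt_pos.2 hp'
  have hqq : q * q = p := Real.mul_self_sqrt hp'.le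
  have h : ∫ ξ, gsDens p ξ * ‖ξ‖
      ≤ ∫ ξ, (1 / (2 * q)) * (gsDens p ξ * ‖ξ‖ ^ 2) + (q / 2) * gsDens p ξ := by
    refine integral_mono gs_integrable_norm
      ((gs_integrable_norm_sq.const_mul _).add (gs_integrable_dens.const_mul _)) fun ξ => ?_
    have : ‖ξ‖ ≤ 1 / (2 * q) * ‖ξ‖ ^ 2 + q / 2 := by
      have : 1 / (2 * q) * ‖ξ‖ ^ 2 + q / 2 - ‖ξ‖ = (‖ξ‖ - q) ^ 2 / (2 * q) := by
        field_simp; ring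
      have : 0 ≤ (‖ξ‖ - q) ^ 2 / (2 * q) := by positivity
      linarith
    have := mul_le_mul_of_nonneg_left this (gsDens_nonneg ξ)
    simp only
    linarith
  rw [integral_add (gs_integrable_norm_sq.const_mul _) (gs_integrable_dens.const_mul _),
    integral_const_mul, integral_const_mul, gs_integral_dens] at h
  have h2 : 1 / (2 * q) * ∫ ξ, gsDens p ξ * ‖ξ‖ ^ 2 ≤ 1 / (2 * q) * p := by
    gcongr; exact gs_integral_norm_sq
  have h3 : 1 / (2 * q) * p = q / 2 := by rw [← hqq]; field_simp
  linarith

lemma gsDens_hasFDerivAt (ξ h : EuclideanSpace ℝ (Fin p)) :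
    HasFDerivAt (fun h => gsDens p (ξ - h)) (gsDens p (ξ - h) • innerSL ℝ (ξ - h)) h := by
  unfold gsDens
  have h1 : HasFDerivAt (fun h : EuclideanSpace ℝ (Fin p) => ξ - h)
      (-ContinuousLinearMap.id ℝ _) h := (hasFDerivAt_id h).const_sub ξ
  have h2 := (((h1.norm_sq).const_mul (-1 / 2 : ℝ)).exp).const_mul ((2 * π) ^ (-(p : ℝ) / 2))
  have e : ∀ t : ℝ, -t ^ 2 / 2 = -1 / 2 * t ^ 2 := fun t => by ring
  simp only [e]
  refine h2.congr_fderiv ?_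
  ext v
  simp
  ring

lemma gsDens_shift_bound (ξ h : EuclideanSpace ℝ (Fin p)) (hh : ‖h‖ ≤ 1) (A : ℝ) (hA : 0 ≤ A)
    (a : ℝ) (ha : |a| ≤ A * (1 + ‖ξ‖)) :
    |a| * (gsDens p (ξ - h) * (1 + ‖ξ - h‖)) ≤
      (2 * π) ^ (-(p : ℝ) / 2) * Real.exp (1 / 2) * (36 * A) * Real.exp (-(1 / 8) * ‖ξ‖ ^ 2) := by
  have h1 : ‖ξ - h‖ ≤ ‖ξ‖ + 1 := (norm_sub_le _ _).trans (by linarith)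
  have h2 : ‖ξ‖ - 1 ≤ ‖ξ - h‖ := by linarith [norm_sub_norm_le ξ h]
  have h3 : -‖ξ - h‖ ^ 2 / 2 ≤ -‖ξ‖ ^ 2 / 4 + 1 / 2 := by
    rcases le_total 1 ‖ξ‖ with h' | h'
    · nlinarith [sq_nonneg (‖ξ‖ - 2)]
    · nlinarith [sq_nonneg (‖ξ - h‖), norm_nonneg ξ]
  have h4 := gs_poly_bound ‖ξ‖ (1 / 8) (by norm_num)
  unfold gsDens
  calc |a| * ((2 * π) ^ (-(p : ℝ) / 2) * Real.exp (-‖ξ - h‖ ^ 2 / 2) * (1 + ‖ξ - h‖))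
      ≤ (A * (1 + ‖ξ‖)) * ((2 * π) ^ (-(p : ℝ) / 2) * Real.exp (-‖ξ‖ ^ 2 / 4 + 1 / 2)
          * (1 + (‖ξ‖ + 1))) := by gcongr
    _ = (2 * π) ^ (-(p : ℝ) / 2) * Real.exp (-‖ξ‖ ^ 2 / 4 + 1 / 2) * A *
          ((1 + ‖ξ‖) * (2 + ‖ξ‖)) := by ring
    _ ≤ (2 * π) ^ (-(p : ℝ) / 2) * Real.exp (-‖ξ‖ ^ 2 / 4 + 1 / 2) * A *
          (4 * ((1 + 1 / (1 / 8)) * Real.exp (1 / 8 * ‖ξ‖ ^ 2))) := by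
        refine mul_le_mul_of_nonneg_left ?_ (by positivity)
        nlinarith [sq_nonneg (‖ξ‖ - 1)]
    _ = (2 * π) ^ (-(p : ℝ) / 2) * (36 * A) *
          (Real.exp (-‖ξ‖ ^ 2 / 4 + 1 / 2) * Real.exp (1 / 8 * ‖ξ‖ ^ 2)) := by ring
    _ = (2 * π) ^ (-(p : ℝ) / 2) * (36 * A) *
          (Real.exp (1 / 2) * Real.exp (-(1 / 8) * ‖ξ‖ ^ 2)) := by
        rw [← Real.exp_add, ← Real.exp_add]; congr 2; ring
    _ = _ := by ring

lemma gs_key (G : EuclideanSpace ℝ (Fin p) → ℝ) (hG : Continuous G) (A : ℝ) (hA : 0 ≤ A)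
    (hb : ∀ ξ, |G ξ| ≤ A * (1 + ‖ξ‖)) :
    Integrable (fun ξ => (G ξ * gsDens p ξ) • ξ) ∧
    HasFDerivAt (fun h => ∫ ξ, gsDens p ξ * G (ξ + h))
      (innerSL ℝ (∫ ξ, (G ξ * gsDens p ξ) • ξ)) 0 := by
  have hc := gsDens_continuous (p := p)
  have hbi := (gs_integrable_exp (p := p) (b := 1 / 8) (by norm_num)).const_mul
    ((2 * π) ^ (-(p : ℝ) / 2) * Real.exp (1 / 2) * (36 * A))
  have hint : Integrable (fun ξ => (G ξ * gsDens p ξ) • ξ) := by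
    refine hbi.mono' (Continuous.aestronglyMeasurable (by fun_prop))
      (Filter.Eventually.of_forall fun ξ => ?_)
    refine le_trans ?_ (gsDens_shift_bound ξ 0 (by simp) A hA (G ξ) (hb ξ))
    rw [norm_smul, norm_mul, Real.norm_eq_abs, Real.norm_of_nonneg (gsDens_nonneg ξ), sub_zero,
      mul_assoc]
    have := gsDens_nonneg ξ
    gcongr
    linarith
  refine ⟨hint, ?_⟩
  have hsh : (fun h => ∫ ξ, gsDens p ξ * G (ξ + h)) = fun h => ∫ ξ, G ξ * gsDens p (ξ - h) := by
    ext h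
    rw [← integral_sub_right_eq_self _ h]
    congr 1; ext ξ; rw [sub_add_cancel, mul_comm]
  rw [hsh, ← ContinuousLinearMap.integral_comp_comm (innerSL ℝ) hint]
  have := hasFDerivAt_integral_of_dominated_of_fderiv_le (μ := (volume : Measure (EuclideanSpace ℝ (Fin p)))) (𝕜 := ℝ)
    (F := fun h ξ => G ξ * gsDens p (ξ - h)) (x₀ := 0) (s := Metric.ball 0 1)
    (F' := fun h ξ => G ξ • (gsDens p (ξ - h) • innerSL ℝ (ξ - h)))
    (bound := fun ξ => (2 * π) ^ (-(p : ℝ) / 2) * Real.exp (1 / 2) * (36 * A)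
      * Real.exp (-(1 / 8) * ‖ξ‖ ^ 2))
    (Metric.ball_mem_nhds _ one_pos)
    (Filter.Eventually.of_forall fun h => Continuous.aestronglyMeasurable (by fun_prop))
    ?_ (Continuous.aestronglyMeasurable (by fun_prop)) ?_ hbi ?_
  · have e : (fun ξ => innerSL ℝ ((G ξ * gsDens p ξ) • ξ)) =
        fun ξ => G ξ • (gsDens p (ξ - 0) • innerSL ℝ (ξ - 0)) := by
      ext ξ v
      simp [inner_smul_left, mul_assoc]
    rw [e]
    exact this
  · refine hbi.mono' (Continuous.aestronglyMeasurable (by fun_prop))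
      (Filter.Eventually.of_forall fun ξ => ?_)
    refine le_trans ?_ (gsDens_shift_bound ξ 0 (by simp) A hA (G ξ) (hb ξ))
    rw [norm_mul, Real.norm_eq_abs, Real.norm_of_nonneg (gsDens_nonneg _)]
    have := gsDens_nonneg (ξ - 0)
    gcongr
    nlinarith [norm_nonneg (ξ - 0)]
  · refine Filter.Eventually.of_forall fun ξ h hh => ?_
    rw [mem_ball_zero_iff] at hh
    refine le_trans ?_ (gsDens_shift_bound ξ h hh.le A hA (G ξ) (hb ξ))
    rw [norm_smul, norm_smul, Real.norm_eq_abs, Real.norm_of_nonneg (gsDens_nonneg _),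
      innerSL_apply_norm]
    have := gsDens_nonneg (ξ - h)
    gcongr
    linarith
  · exact Filter.Eventually.of_forall fun ξ h _ => (gsDens_hasFDerivAt ξ h).const_mul (G ξ)

lemma gs_gradient (μ D : ℝ) (hμ : 0 < μ) (hD : 0 ≤ D) (f : EuclideanSpace ℝ (Fin p) → ℝ)
    (hlip : LipschitzWith D.toNNReal f) (x : EuclideanSpace ℝ (Fin p)) :
    Integrable (fun ξ => (f (x + μ • ξ) * gsDens p ξ) • ξ) ∧
    gradient (fun z => ∫ ξ, f (z + μ • ξ) ∂(stdGaussian p)) x =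
      μ⁻¹ • ∫ ξ, (f (x + μ • ξ) * gsDens p ξ) • ξ := by
  have hfc := hlip.continuous
  obtain ⟨h1, h2⟩ := gs_key (fun ξ => f (x + μ • ξ)) (by fun_prop) (|f x| + D * μ) (by positivity)
    (fun ξ => by
      have := hlip.dist_le_mul (x + μ • ξ) x
      rw [Real.dist_eq, dist_eq_norm, add_sub_cancel_left, norm_smul, Real.norm_of_nonneg hμ.le,
        Real.coe_toNNReal _ hD] at this
      have h3 : |f (x + μ • ξ)| ≤ |f (x + μ • ξ) - f x| + |f x| := by
        have := abs_add_le (f (x + μ • ξ) - f x) (f x)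
        rwa [sub_add_cancel] at this
      have h4 : 0 ≤ |f x| * ‖ξ‖ := by positivity
      have h5 : 0 ≤ D * μ := by positivity
      nlinarith)
  refine ⟨h1, HasGradientAt.gradient ?_⟩
  rw [hasGradientAt_iff_hasFDerivAt]
  have hT : HasFDerivAt (fun z : EuclideanSpace ℝ (Fin p) => μ⁻¹ • (z - x))
      (μ⁻¹ • ContinuousLinearMap.id ℝ _) x := ((hasFDerivAt_id x).sub_const x).const_smul μ⁻¹
  have h2' : HasFDerivAt (fun h => ∫ ξ, gsDens p ξ * f (x + μ • (ξ + h)))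
      (innerSL ℝ (∫ ξ, (f (x + μ • ξ) * gsDens p ξ) • ξ)) (μ⁻¹ • (x - x)) := by
    rw [sub_self, smul_zero]; exact h2
  have h3 := HasFDerivAt.comp (f := fun z : EuclideanSpace ℝ (Fin p) => μ⁻¹ • (z - x)) x h2' hT
  have e : (fun z => ∫ ξ, f (z + μ • ξ) ∂(stdGaussian p)) =
      (fun h => ∫ ξ, gsDens p ξ * f (x + μ • (ξ + h))) ∘
        fun z : EuclideanSpace ℝ (Fin p) => μ⁻¹ • (z - x) := by
    ext z
    simp only [Function.comp_apply, gs_integral]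
    congr 1; ext ξ
    rw [smul_add, smul_smul, mul_inv_cancel₀ hμ.ne', one_smul]
    congr 2; abel
  rw [e]
  refine h3.congr_fderiv ?_
  ext v
  simp

end helpers

theorem gaussian_smoothing_gradient_lipschitz (p : ℕ) (hp : 1 ≤ p) (μ D : ℝ)
    (hμ : 0 < μ) (hD : 0 ≤ D)
    (f : EuclideanSpace ℝ (Fin p) → ℝ)
    (hconv : ConvexOn ℝ Set.univ f) (hlip : LipschitzWith D.toNNReal f)
    (x y : EuclideanSpace ℝ (Fin p)) :
    ‖gradient (fun z => ∫ ξ, f (z + μ • ξ) ∂(stdGaussian p)) x -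
        gradient (fun z => ∫ ξ, f (z + μ • ξ) ∂(stdGaussian p)) y‖ ≤
      Real.sqrt p * D / μ * ‖x - y‖ := by
  obtain ⟨ix, gx⟩ := gs_gradient μ D hμ hD f hlip x
  obtain ⟨iy, gy⟩ := gs_gradient μ D hμ hD f hlip y
  rw [gx, gy, ← smul_sub, ← integral_sub ix iy, norm_smul, norm_inv, Real.norm_of_nonneg hμ.le]
  have h : ‖∫ ξ, ((f (x + μ • ξ) * gsDens p ξ) • ξ - (f (y + μ • ξ) * gsDens p ξ) • ξ)‖
      ≤ ∫ ξ, (D * ‖x - y‖) * (gsDens p ξ * ‖ξ‖) := by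
    refine norm_integral_le_of_norm_le (gs_integrable_norm.const_mul _)
      (Filter.Eventually.of_forall fun ξ => ?_)
    rw [← sub_smul, ← sub_mul, norm_smul, norm_mul, Real.norm_of_nonneg (gsDens_nonneg ξ),
      mul_assoc]
    have := hlip.dist_le_mul (x + μ • ξ) (y + μ • ξ)
    rw [dist_eq_norm, dist_eq_norm, add_sub_add_right_eq_sub, Real.coe_toNNReal _ hD] at this
    exact mul_le_mul_of_nonneg_right this (mul_nonneg (gsDens_nonneg ξ) (norm_nonneg _))
  rw [integral_const_mul] at h
  have h2 : (D * ‖x - y‖) * ∫ ξ, gsDens p ξ * ‖ξ‖ ≤ (D * ‖x - y‖) * Real.sqrt p :=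
    mul_le_mul_of_nonneg_left (gs_integral_norm hp) (by positivity)
  calc μ⁻¹ * _ ≤ μ⁻¹ * ((D * ‖x - y‖) * Real.sqrt p) := by gcongr; exact h.trans h2
    _ = _ := by field_simp
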